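/- arXiv:math/0005013 — 2 statements merged into one kernel-verified Lean document; each statement's English description precedes it below -/
import Mathlib

section
/- Let K be a compact metric space, f a Baire class one function on K, β₀, γ₀ countable ordinals ≥ 1 with β(f) ≤ β₀·γ₀, and ε > 0. Then there exist a function f̃ : K → ℝ and a sequence fₙ : K → ℝ such that (fₙ) converges pointwise to f̃, ‖f̃ − f‖_∞ ≤ ε, β(fₙ) ≤ β₀ for all n, and γ((fₙ)) ≤ γ₀. -/
open Filter Topology Set Ordinal

noncomputable section

/-- One step of the oscillation derivation of `A` with respect to `f` and `ε`. -/
def oscStep {K : Type*} [TopologicalSpace K] (f : K → ℝ) (ε : ℝ) (A : Set K) : Set K :=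
  {x ∈ A | ∀ U : Set K, IsOpen U → x ∈ U →
    ∃ x₁ ∈ U ∩ A, ∃ x₂ ∈ U ∩ A, ε ≤ |f x₁ - f x₂|}

/-- The transfinite oscillation derivatives `H^α(f, ε)`. -/
def oscDeriv {K : Type*} [TopologicalSpace K] (f : K → ℝ) (ε : ℝ) (H : Set K) :
    Ordinal → Set K := fun α =>
  Ordinal.limitRecOn α H (fun _ ih => oscStep f ε ih)
    (fun _ _ ih => ⋂ (β : Ordinal) (h : _), ih β h)

/-- One step of the convergence derivation of `A` for a sequence `f`. -/
def seqStep {K : Type*} [TopologicalSpace K] (f : ℕ → K → ℝ) (ε : ℝ) (A : Set K) : Set K :=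
  {x ∈ A | ∀ U : Set K, IsOpen U → x ∈ U → ∀ m : ℕ,
    ∃ n₁ n₂ : ℕ, m < n₂ ∧ n₂ < n₁ ∧ ∃ x' ∈ U ∩ A, ε ≤ |f n₁ x' - f n₂ x'|}

/-- The transfinite convergence derivatives `H^α((fₙ), ε)`. -/
def seqDeriv {K : Type*} [TopologicalSpace K] (f : ℕ → K → ℝ) (ε : ℝ) (H : Set K) :
    Ordinal → Set K := fun α =>
  Ordinal.limitRecOn α H (fun _ ih => seqStep f ε ih)
    (fun _ _ ih => ⋂ (β : Ordinal) (h : _), ih β h)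

open Classical in
/-- The least ordinal at which the family `S` is empty, and `ω₁` if there is none. -/
def emptyIndex {K : Type*} (S : Ordinal → Set K) : Ordinal :=
  if _ : ∃ α, S α = ∅ then sInf {α | S α = ∅} else (Cardinal.aleph 1).ord

/-- The oscillation index `β_H(f, ε)`. -/
def betaEpsOn {K : Type*} [TopologicalSpace K] (f : K → ℝ) (ε : ℝ) (H : Set K) : Ordinal :=
  emptyIndex (oscDeriv f ε H)

/-- The oscillation index `β_H(f)`. -/
def betaOn {K : Type*} [TopologicalSpace K] (f : K → ℝ) (H : Set K) : Ordinal :=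
  ⨆ ε : {e : ℝ // 0 < e}, betaEpsOn f ε.1 H

/-- The oscillation index `β(f)` over the whole space. -/
def beta {K : Type*} [TopologicalSpace K] (f : K → ℝ) : Ordinal :=
  betaOn f Set.univ

/-- The convergence index `γ_H((fₙ), ε)`. -/
def gammaEpsOn {K : Type*} [TopologicalSpace K] (f : ℕ → K → ℝ) (ε : ℝ) (H : Set K) : Ordinal :=
  emptyIndex (seqDeriv f ε H)

/-- The convergence index `γ_H((fₙ))`. -/
def gammaOn {K : Type*} [TopologicalSpace K] (f : ℕ → K → ℝ) (H : Set K) : Ordinal :=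
  ⨆ ε : {e : ℝ // 0 < e}, gammaEpsOn f ε.1 H

/-- The convergence index `γ((fₙ))` over the whole space. -/
def gamma {K : Type*} [TopologicalSpace K] (f : ℕ → K → ℝ) : Ordinal :=
  gammaOn f Set.univ

/-- A function is of Baire class one if it is a pointwise limit of continuous functions. -/
def BaireOne {K : Type*} [TopologicalSpace K] (f : K → ℝ) : Prop :=
  ∃ F : ℕ → K → ℝ, (∀ n, Continuous (F n)) ∧
    ∀ x, Tendsto (fun n => F n x) atTop (nhds (f x))

/-- `f` is of Baire class one on the subspace `F`. -/
def BaireOneOn {K : Type*} [TopologicalSpace K] (f : K → ℝ) (F : Set K) : Prop :=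
  ∃ g : ℕ → F → ℝ, (∀ n, Continuous (g n)) ∧
    ∀ x : F, Tendsto (fun n => g n x) atTop (nhds (f x))

/-- `g` is a convex block combination of `f`. -/
def ConvexBlockOf {K : Type*} (g f : ℕ → K → ℝ) : Prop :=
  ∃ a : ℕ → ℝ, ∃ p : ℕ → ℕ, (∀ k, 0 ≤ a k) ∧ StrictMono p ∧ p 0 = 0 ∧
    (∀ n, ∑ k ∈ Finset.Ioc (p n) (p (n + 1)), a k = 1) ∧
    ∀ n x, g n x = ∑ k ∈ Finset.Ioc (p n) (p (n + 1)), a k * f k x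

end

section helpers

variable {K : Type*}

theorem oscDeriv_zero [TopologicalSpace K] (f : K → ℝ) (ε : ℝ) (H : Set K) :
    oscDeriv f ε H 0 = H := by
  simp [oscDeriv]

theorem oscDeriv_succ [TopologicalSpace K] (f : K → ℝ) (ε : ℝ) (H : Set K) (α : Ordinal) :
    oscDeriv f ε H (α + 1) = oscStep f ε (oscDeriv f ε H α) := by
  simp only [oscDeriv]
  rw [Ordinal.limitRecOn_add_one]

theorem oscDeriv_limit [TopologicalSpace K] (f : K → ℝ) (ε : ℝ) (H : Set K) (α : Ordinal)
    (h : Order.IsSuccLimit α) :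
    oscDeriv f ε H α = ⋂ (β : Ordinal) (_ : β < α), oscDeriv f ε H β := by
  simp only [oscDeriv]
  rw [Ordinal.limitRecOn_limit _ _ _ _ h]

theorem seqDeriv_zero [TopologicalSpace K] (f : ℕ → K → ℝ) (ε : ℝ) (H : Set K) :
    seqDeriv f ε H 0 = H := by
  simp [seqDeriv]

theorem seqDeriv_succ [TopologicalSpace K] (f : ℕ → K → ℝ) (ε : ℝ) (H : Set K) (α : Ordinal) :
    seqDeriv f ε H (α + 1) = seqStep f ε (seqDeriv f ε H α) := by
  simp only [seqDeriv]
  rw [Ordinal.limitRecOn_add_one]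

theorem seqDeriv_limit [TopologicalSpace K] (f : ℕ → K → ℝ) (ε : ℝ) (H : Set K) (α : Ordinal)
    (h : Order.IsSuccLimit α) :
    seqDeriv f ε H α = ⋂ (β : Ordinal) (_ : β < α), seqDeriv f ε H β := by
  simp only [seqDeriv]
  rw [Ordinal.limitRecOn_limit _ _ _ _ h]

theorem oscStep_mono [TopologicalSpace K] (f : K → ℝ) (ε : ℝ) {A B : Set K} (h : A ⊆ B) :
    oscStep f ε A ⊆ oscStep f ε B := by
  rintro x ⟨hx, hU⟩
  refine ⟨h hx, fun U hUo hxU => ?_⟩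
  obtain ⟨a, ha, b, hb, hab⟩ := hU U hUo hxU
  exact ⟨a, ⟨ha.1, h ha.2⟩, b, ⟨hb.1, h hb.2⟩, hab⟩

theorem seqStep_mono [TopologicalSpace K] (f : ℕ → K → ℝ) (ε : ℝ) {A B : Set K} (h : A ⊆ B) :
    seqStep f ε A ⊆ seqStep f ε B := by
  rintro x ⟨hx, hU⟩
  refine ⟨h hx, fun U hUo hxU m => ?_⟩
  obtain ⟨n₁, n₂, h1, h2, a, ha, hab⟩ := hU U hUo hxU m
  exact ⟨n₁, n₂, h1, h2, a, ⟨ha.1, h ha.2⟩, hab⟩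

theorem oscDeriv_sub [TopologicalSpace K] (f : K → ℝ) (ε : ℝ) (B : Ordinal → Set K)
    (h0 : ∀ x, x ∈ B 0) (hs : ∀ α, oscStep f ε (B α) ⊆ B (α + 1))
    (hl : ∀ α, Order.IsSuccLimit α → ∀ x, (∀ β < α, x ∈ B β) → x ∈ B α) (α : Ordinal) :
    oscDeriv f ε univ α ⊆ B α := by
  induction α using Ordinal.limitRecOn with
  | zero => exact fun x _ => h0 x
  | add_one α ih =>
    rw [oscDeriv_succ]
    exact (oscStep_mono f ε ih).trans (hs α)
  | limit α h ih =>
    rw [oscDeriv_limit _ _ _ _ h]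
    intro x hx
    refine hl α h x fun β hβ => ih β hβ ?_
    simp only [mem_iInter] at hx
    exact hx β hβ

theorem seqDeriv_sub [TopologicalSpace K] (f : ℕ → K → ℝ) (ε : ℝ) (B : Ordinal → Set K)
    (h0 : ∀ x, x ∈ B 0) (hs : ∀ α, seqStep f ε (B α) ⊆ B (α + 1))
    (hl : ∀ α, Order.IsSuccLimit α → ∀ x, (∀ β < α, x ∈ B β) → x ∈ B α) (α : Ordinal) :
    seqDeriv f ε univ α ⊆ B α := by
  induction α using Ordinal.limitRecOn with
  | zero => exact fun x _ => h0 x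
  | add_one α ih =>
    rw [seqDeriv_succ]
    exact (seqStep_mono f ε ih).trans (hs α)
  | limit α h ih =>
    rw [seqDeriv_limit _ _ _ _ h]
    intro x hx
    refine hl α h x fun β hβ => ih β hβ ?_
    simp only [mem_iInter] at hx
    exact hx β hβ

theorem emptyIndex_le {S : Ordinal → Set K} {α : Ordinal} (h : S α = ∅) :
    emptyIndex S ≤ α := by
  have h' : ∃ α, S α = ∅ := ⟨α, h⟩
  rw [emptyIndex, dif_pos h']
  exact csInf_le' h

theorem emptyIndex_spec {S : Ordinal → Set K} (h : emptyIndex S < (Cardinal.aleph 1).ord) :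
    S (emptyIndex S) = ∅ := by
  by_cases h' : ∃ α, S α = ∅
  · rw [emptyIndex, dif_pos h']
    exact csInf_mem (s := {α | S α = ∅}) h'
  · rw [emptyIndex, dif_neg h'] at h
    exact absurd h (lt_irrefl _)

theorem oscDeriv_anti [TopologicalSpace K] (f : K → ℝ) (ε : ℝ) {α β : Ordinal} (h : α ≤ β) :
    oscDeriv f ε univ β ⊆ oscDeriv f ε univ α := by
  induction β using Ordinal.limitRecOn with
  | zero =>
    have : α = 0 := le_antisymm h (zero_le)
    rw [this]
  | add_one β ih =>
    rcases h.lt_or_eq with h | h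
    · rw [oscDeriv_succ]
      exact fun x hx => ih (Order.lt_add_one_iff.1 h) hx.1
    · rw [h]
  | limit β hl ih =>
    rcases h.lt_or_eq with h | h
    · rw [oscDeriv_limit _ _ _ _ hl]
      exact fun x hx => by
        simp only [mem_iInter] at hx
        exact hx α h
    · rw [h]

theorem oscStep_closed [TopologicalSpace K] (f : K → ℝ) (ε : ℝ) {A : Set K} (h : IsClosed A) :
    IsClosed (oscStep f ε A) := by
  rw [← isOpen_compl_iff, isOpen_iff_mem_nhds]
  intro x hx
  by_cases hxA : x ∈ A
  · have : ∃ U : Set K, IsOpen U ∧ x ∈ U ∧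
        ∀ x₁ ∈ U ∩ A, ∀ x₂ ∈ U ∩ A, |f x₁ - f x₂| < ε := by
      by_contra hc
      push Not at hc
      exact hx ⟨hxA, fun U hU hxU => hc U hU hxU⟩
    obtain ⟨U, hU, hxU, hlt⟩ := this
    filter_upwards [hU.mem_nhds hxU] with y hy hyo
    obtain ⟨a, ha, b, hb, hab⟩ := hyo.2 U hU hy
    exact absurd hab (not_le.2 (hlt a ha b hb))
  · filter_upwards [h.isOpen_compl.mem_nhds hxA] with y hy hyo
    exact hy hyo.1

theorem oscDeriv_closed [TopologicalSpace K] (f : K → ℝ) (ε : ℝ) (α : Ordinal) :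
    IsClosed (oscDeriv f ε univ α) := by
  induction α using Ordinal.limitRecOn with
  | zero => rw [oscDeriv_zero]; exact isClosed_univ
  | add_one α ih => rw [oscDeriv_succ]; exact oscStep_closed f ε ih
  | limit α h ih =>
    rw [oscDeriv_limit _ _ _ _ h]
    exact isClosed_iInter fun β => isClosed_iInter fun hβ => ih β hβ

theorem notMem_oscStep [TopologicalSpace K] {f : K → ℝ} {ε : ℝ} (hε : 0 < ε) {A : Set K} {x : K}
    (h : ContinuousWithinAt f A x) : x ∉ oscStep f ε A := by
  rintro ⟨hx, hU⟩
  have h1 : ∀ᶠ y in 𝓝[A] x, |f y - f x| < ε / 2 := by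
    have := Metric.tendsto_nhds.1 h (ε / 2) (by positivity)
    simpa [Real.dist_eq] using this
  obtain ⟨U, hUo, hxU, hUA⟩ := mem_nhdsWithin.1 h1
  obtain ⟨a, ha, b, hb, hab⟩ := hU U hUo hxU
  have ha' : |f a - f x| < ε / 2 := hUA ha
  have hb' : |f b - f x| < ε / 2 := hUA hb
  rw [abs_lt] at ha' hb'
  have : |f a - f b| < ε := by rw [abs_lt]; constructor <;> linarith
  linarith

theorem core [MetricSpace K] (ρ : K → Ordinal) (ft : K → ℝ) (β₀ γ₀ : Ordinal)
    (hβ₀ : 1 ≤ β₀) (hcl : ∀ α, IsClosed {x | α ≤ ρ x})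
    (hft : ∀ x, ContinuousWithinAt ft {y | ρ y = ρ x} x)
    (hρ : ∀ x, ρ x < β₀ * γ₀) (hc : (Iio γ₀).Countable) :
    ∃ F : ℕ → K → ℝ,
      (∀ x, Tendsto (fun n => F n x) atTop (nhds (ft x))) ∧
      (∀ n, beta (F n) ≤ β₀) ∧ gamma F ≤ γ₀ := by
  classical
  have hb0 : β₀ ≠ 0 := by rintro rfl; simp at hβ₀
  obtain ⟨e, he⟩ := Set.countable_iff_exists_injOn.1 hc
  set q : K → Ordinal := fun x => ρ x / β₀ with hq
  set r : K → Ordinal := fun x => ρ x % β₀ with hr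
  have hqr : ∀ x, β₀ * q x + r x = ρ x := fun x => Ordinal.div_add_mod _ _
  have hrlt : ∀ x, r x < β₀ := fun x => Ordinal.mod_lt _ hb0
  have hqlt : ∀ x, q x < γ₀ := fun x => (Ordinal.div_lt hb0).2 (hρ x)
  have hG : ∀ γ, {x | γ ≤ q x} = {x | β₀ * γ ≤ ρ x} := by
    intro γ
    ext x
    exact Ordinal.le_div hb0
  have hGcl : ∀ γ, IsClosed {x | γ ≤ q x} := fun γ => by rw [hG]; exact hcl _
  set δ : ℕ → ℝ := fun n => 1 / ((n : ℝ) + 1) with hδ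
  have hδpos : ∀ n, 0 < δ n := fun n => by positivity
  set P : ℕ → Ordinal → Set K := fun n γ =>
    {x | γ ≤ q x} \ Metric.thickening (δ n) {x | γ + 1 ≤ q x} with hP
  have hPcl : ∀ n γ, IsClosed (P n γ) := fun n γ =>
    (hGcl γ).sdiff Metric.isOpen_thickening
  have hPq : ∀ n γ x, x ∈ P n γ → q x = γ := by
    rintro n γ x ⟨h1, h2⟩
    refine le_antisymm ?_ h1
    by_contra hlt
    exact h2 (Metric.self_subset_thickening (hδpos n) _ (Order.add_one_le_of_lt (not_le.1 hlt)))
  set T : ℕ → Set Ordinal := fun n => {γ | γ < γ₀ ∧ e γ ≤ n} with hT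
  have hTfin : ∀ n, (T n).Finite := by
    intro n
    refine Set.Finite.of_finite_image (f := e) ((Set.finite_Iic n).subset ?_) ?_
    · rintro _ ⟨γ, hγ, rfl⟩
      exact hγ.2
    · exact he.mono fun γ hγ => hγ.1
  set L : ℕ → Set K := fun n => ⋃ γ ∈ T n, P n γ with hL
  have hLcl : ∀ n, IsClosed (L n) := fun n =>
    (hTfin n).isClosed_biUnion fun γ _ => hPcl n γ
  -- local structure of `L n`
  have hloc : ∀ n x, x ∈ L n → ∀ᶠ y in 𝓝 x, y ∈ L n → q y = q x ∧ r y ≤ r x := by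
    intro n x hx
    have h1 : IsClosed (⋃ γ ∈ T n \ {q x}, P n γ) :=
      ((hTfin n).subset diff_subset).isClosed_biUnion fun γ _ => hPcl n γ
    have hx1 : x ∉ ⋃ γ ∈ T n \ {q x}, P n γ := by
      simp only [mem_iUnion, not_exists]
      intro γ hγ hxP
      exact hγ.2 (hPq n γ x hxP).symm
    have hx2 : x ∉ {y | ρ x + 1 ≤ ρ y} := by
      simp
    filter_upwards [h1.isOpen_compl.mem_nhds hx1, (hcl (ρ x + 1)).isOpen_compl.mem_nhds hx2]
      with y hy1 hy2 hyL
    have hqy : q y = q x := by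
      by_contra hne
      apply hy1
      simp only [hL, mem_iUnion] at hyL ⊢
      obtain ⟨γ, hγ, hyP⟩ := hyL
      have := hPq n γ y hyP
      exact ⟨γ, ⟨hγ, fun h => hne (this.trans h)⟩, hyP⟩
    refine ⟨hqy, ?_⟩
    have hy3 : ρ y ≤ ρ x := by
      have : ¬ (ρ x + 1 ≤ ρ y) := hy2
      exact Order.lt_add_one_iff.1 (not_le.1 this)
    rw [← hqr x, ← hqr y, hqy] at hy3
    exact (add_le_add_iff_left _).1 hy3
  set D : ℕ → Set K := fun n => {x | x ∈ L n ∧ 1 ≤ r x} with hD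
  have hDcl : ∀ n, IsClosed (D n) := by
    intro n
    rw [← isOpen_compl_iff, isOpen_iff_mem_nhds]
    intro x hx
    by_cases hxL : x ∈ L n
    · filter_upwards [hloc n x hxL] with y hy hyD
      exact hx ⟨hxL, hyD.2.trans (hy hyD.1).2⟩
    · filter_upwards [(hLcl n).isOpen_compl.mem_nhds hxL] with y hy hyD
      exact hy hyD.1
  -- continuity of `ft` on the pieces
  have hcont : ∀ n α x, x ∈ L n → r x = α →
      ContinuousWithinAt ft {y | y ∈ L n ∧ α ≤ r y} x := by
    intro n α x hx hrx
    refine (hft x).mono_of_mem_nhdsWithin ?_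
    rw [mem_nhdsWithin_iff_eventually]
    filter_upwards [hloc n x hx] with y hy hyL
    obtain ⟨h1, h2⟩ := hy hyL.1
    have h3 : r y = r x := le_antisymm h2 (hrx.trans_le hyL.2)
    show ρ y = ρ x
    rw [← hqr x, ← hqr y, h1, h3]
  have hext : ∀ n, ∃ g : K → ℝ, (∀ x ∈ L n, g x = ft x) ∧ (∀ x ∉ D n, ContinuousAt g x) := by
    intro n
    let X := {x // x ∈ (D n)ᶜ}
    let s : Set X := Subtype.val ⁻¹' (L n)
    have hs : IsClosed s := (hLcl n).preimage continuous_subtype_val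
    have hfs : Continuous (fun y : s => ft y.1.1) := by
      rw [continuous_iff_continuousAt]
      rintro ⟨⟨x, hxD⟩, hxL⟩
      have hxL' : x ∈ L n := hxL
      have hx0 : r x = 0 := by
        by_contra h0
        exact hxD ⟨hxL', Order.one_le_iff_pos.2 (pos_iff_ne_zero.2 h0)⟩
      have := hcont n 0 x hxL' hx0
      refine Tendsto.comp (y := 𝓝[{y | y ∈ L n ∧ 0 ≤ r y}] x) this ?_
      refine tendsto_nhdsWithin_iff.2 ⟨?_, Eventually.of_forall fun y => ⟨y.2, zero_le⟩⟩
      exact (continuous_subtype_val.comp continuous_subtype_val).continuousAt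
    obtain ⟨h, hh⟩ := ContinuousMap.exists_restrict_eq hs (⟨_, hfs⟩ : C(s, ℝ))
    refine ⟨fun x => if hx : x ∈ (D n)ᶜ then h ⟨x, hx⟩ else ft x, ?_, ?_⟩
    · intro x hx
      by_cases hxD : x ∈ (D n)ᶜ
      · simp only [dif_pos hxD]
        have := DFunLike.congr_fun hh ⟨⟨x, hxD⟩, hx⟩
        simpa using this
      · simp only [dif_neg hxD]
    · intro x hx
      have hx' : x ∈ (D n)ᶜ := hx
      have ho : IsOpen (D n)ᶜ := (hDcl n).isOpen_compl
      refine ContinuousOn.continuousAt (s := (D n)ᶜ) ?_ (ho.mem_nhds hx')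
      rw [continuousOn_iff_continuous_domRestrict]
      convert h.continuous using 1
      ext y
      exact dif_pos y.2
  choose F hF hFc using hext
  -- eventual agreement
  have hev : ∀ x, ∃ U : Set K, IsOpen U ∧ x ∈ U ∧ ∃ m : ℕ, ∀ n ≥ m, ∀ y ∈ U,
      q x ≤ q y → F n y = ft y := by
    intro x
    have hx : x ∉ closure {y | q x + 1 ≤ q y} := by
      rw [(hGcl _).closure_eq]
      simp
    rw [Metric.mem_closure_iff_infEDist_zero] at hx
    obtain ⟨k, hk⟩ : ∃ k : ℕ, ENNReal.ofReal (δ k) <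
        Metric.infEDist x {y | q x + 1 ≤ q y} := by
      have ht : Tendsto (fun k => ENNReal.ofReal (δ k)) atTop (𝓝 0) := by
        have := ENNReal.tendsto_ofReal (tendsto_one_div_add_atTop_nhds_zero_nat (𝕜 := ℝ))
        simpa [hδ] using this
      exact (ht.eventually_lt_const (pos_iff_ne_zero.2 hx)).exists
    refine ⟨(Metric.cthickening (δ k) {y | q x + 1 ≤ q y})ᶜ,
      Metric.isClosed_cthickening.isOpen_compl, fun h => absurd h (not_le.2 hk),
      max k (e (q x)), ?_⟩
    intro n hn y hy hqy
    apply hF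
    simp only [hL, mem_iUnion]
    refine ⟨q x, ⟨hqlt x, (le_max_right _ _).trans hn⟩, hqy, fun hth => hy ?_⟩
    apply Metric.thickening_subset_cthickening
    refine Metric.thickening_mono ?_ _ hth
    exact one_div_le_one_div_of_le (by positivity)
      (by have : k ≤ n := (le_max_left _ _).trans hn
          have : (k : ℝ) ≤ n := by exact_mod_cast this
          linarith)
  refine ⟨F, ?_, ?_, ?_⟩
  · intro x
    obtain ⟨U, -, hxU, m, hm⟩ := hev x
    refine tendsto_const_nhds.congr' ?_
    filter_upwards [eventually_ge_atTop m] with n hn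
    exact (hm n hn x hxU le_rfl).symm
  · intro n
    refine ciSup_le' ?_
    rintro ⟨η, hη⟩
    refine emptyIndex_le (eq_empty_of_subset_empty ?_)
    refine (oscDeriv_sub (F n) η (fun α => {x | α = 0 ∨ (x ∈ L n ∧ α ≤ r x)}) ?_ ?_ ?_ β₀).trans ?_
    · exact fun x => Or.inl rfl
    · intro α x hx
      by_contra hxn
      by_cases hα : α = 0
      · subst hα
        have hxD : x ∉ D n := fun h => hxn (Or.inr ⟨h.1, by simpa using h.2⟩)
        exact notMem_oscStep hη (hFc n x hxD).continuousWithinAt hx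
      · have hx1 : x ∈ L n ∧ α ≤ r x := hx.1.resolve_left hα
        have hrx : r x = α := by
          refine le_antisymm ?_ hx1.2
          by_contra hlt
          exact hxn (Or.inr ⟨hx1.1, Order.add_one_le_of_lt (not_le.1 hlt)⟩)
        refine notMem_oscStep hη ?_ hx
        have heq : {x | α = 0 ∨ (x ∈ L n ∧ α ≤ r x)} = {y | y ∈ L n ∧ α ≤ r y} := by
          ext y; simp [hα]
        rw [heq]
        exact (hcont n α x hx1.1 hrx).congr (fun y hy => hF n y hy.1) (hF n x hx1.1)
    · intro α hα x hx
      right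
      have h1 := (hx 1 (by
        have := hα.add_one_lt (show (0 : Ordinal) < α from hα.bot_lt)
        simpa using this)).resolve_left one_ne_zero
      refine ⟨h1.1, ?_⟩
      by_contra hlt
      have h2 := hα.add_one_lt (not_le.1 hlt)
      have h3 := (hx _ h2).resolve_left (by simp)
      exact absurd h3.2 (not_le.2 (Order.lt_add_one_iff.2 le_rfl))
    · rintro x (h | h)
      · exact hb0 h
      · exact absurd h.2 (not_le.2 (hrlt x))
  · refine ciSup_le' ?_
    rintro ⟨η, hη⟩
    refine emptyIndex_le (eq_empty_of_subset_empty ?_)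
    refine (seqDeriv_sub F η (fun γ => {x | γ ≤ q x}) ?_ ?_ ?_ γ₀).trans ?_
    · exact fun x => (zero_le : 0 ≤ q x)
    · intro γ x hx
      by_contra hxn
      have hqx : q x = γ := le_antisymm
        (Order.lt_add_one_iff.1 (not_le.1 hxn)) hx.1
      obtain ⟨U, hU, hxU, m, hm⟩ := hev x
      obtain ⟨n₁, n₂, h1, h2, y, hy, hle⟩ := hx.2 U hU hxU m
      have hqy : q x ≤ q y := hqx.trans_le hy.2
      rw [hm n₁ (h1.trans h2).le y hy.1 hqy, hm n₂ h1.le y hy.1 hqy, _root_.sub_self, abs_zero] at hle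
      exact absurd hle (not_le.2 hη)
    · intro α hα x hx
      by_contra hlt
      have h2 := hα.add_one_lt (not_le.1 hlt)
      exact absurd (show q x + 1 ≤ q x from hx _ h2) (not_le.2 (Order.lt_add_one_iff.2 le_rfl))
    · exact fun x hx => absurd (hqlt x) (not_lt.2 hx)

end helpers

theorem statement10 {K : Type*} [MetricSpace K] [CompactSpace K]
    (f : K → ℝ) (hf : BaireOne f) (β₀ γ₀ : Ordinal)
    (hβ₀1 : 1 ≤ β₀) (hβ₀ : β₀ < (Cardinal.aleph 1).ord)
    (hγ₀1 : 1 ≤ γ₀) (hγ₀ : γ₀ < (Cardinal.aleph 1).ord)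
    (hβ : beta f ≤ β₀ * γ₀) (ε : ℝ) (hε : 0 < ε) :
    ∃ ft : K → ℝ, ∃ F : ℕ → K → ℝ,
      (∀ x, Tendsto (fun n => F n x) atTop (nhds (ft x))) ∧
      (∀ x, |ft x - f x| ≤ ε) ∧
      (∀ n, beta (F n) ≤ β₀) ∧ gamma F ≤ γ₀ := by
  have hlt : β₀ * γ₀ < (Cardinal.aleph 1).ord := by
    rw [Cardinal.lt_ord, Cardinal.lt_aleph_one_iff] at *
    rw [Ordinal.card_mul]
    exact (mul_le_mul' hβ₀ hγ₀).trans Cardinal.aleph0_mul_aleph0.le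
  set H : Ordinal → Set K := oscDeriv f ε univ with hH
  have hle : emptyIndex H ≤ β₀ * γ₀ := by
    refine le_trans ?_ hβ
    unfold beta betaOn
    exact le_ciSup Ordinal.bddAbove_of_small (⟨ε, hε⟩ : {e : ℝ // 0 < e})
  have hemp : H (β₀ * γ₀) = ∅ := by
    have h1 := emptyIndex_spec (hle.trans_lt hlt)
    exact eq_empty_of_subset_empty ((oscDeriv_anti f ε hle).trans h1.le)
  have hne : ∀ x, {α : Ordinal | x ∉ H (α + 1)}.Nonempty := by
    intro x
    refine ⟨β₀ * γ₀, fun hx => ?_⟩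
    have := oscDeriv_anti f ε (Order.lt_add_one_iff.2 le_rfl).le hx
    rw [← hH, hemp] at this
    exact this
  set ρ : K → Ordinal := fun x => sInf {α : Ordinal | x ∉ H (α + 1)} with hρ
  have hρs : ∀ x, x ∉ H (ρ x + 1) := fun x => csInf_mem (hne x)
  have hρH : ∀ α x, α ≤ ρ x ↔ x ∈ H α := by
    intro α x
    constructor
    · induction α using Ordinal.limitRecOn with
      | zero => intro _; rw [hH, oscDeriv_zero]; trivial
      | add_one α _ =>
        intro h
        by_contra hc
        exact absurd (csInf_le' (show α ∈ {α : Ordinal | x ∉ H (α + 1)} from hc))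
          (not_le.2 (Order.add_one_le_iff.1 h))
      | limit α hl ih =>
        intro h
        rw [hH, oscDeriv_limit _ _ _ _ hl]
        simp only [mem_iInter]
        exact fun β hβ => ih β hβ (hβ.le.trans h)
    · intro hx
      by_contra hc
      exact hρs x (oscDeriv_anti f ε (Order.add_one_le_of_lt (not_le.1 hc)) hx)
  have happ : ∀ σ, ∃ g : C({x // ρ x = σ}, ℝ), ∀ x, g x ∈ Icc (f x.1 - ε) (f x.1 + ε) := by
    intro σ
    refine exists_continuous_forall_mem_convex_of_local_const
      (t := fun x : {x // ρ x = σ} => Icc (f x.1 - ε) (f x.1 + ε))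
      (fun x => convex_Icc _ _) ?_
    rintro ⟨x, hx⟩
    refine ⟨f x, ?_⟩
    have h1 : x ∈ H σ := (hρH σ x).1 hx.ge
    have h2 : x ∉ oscStep f ε (H σ) := by
      have := hρs x
      rwa [hx, hH, oscDeriv_succ] at this
    have : ∃ U : Set K, IsOpen U ∧ x ∈ U ∧
        ∀ x₁ ∈ U ∩ H σ, ∀ x₂ ∈ U ∩ H σ, |f x₁ - f x₂| < ε := by
      by_contra hc
      push Not at hc
      exact h2 ⟨h1, fun U hU hxU => hc U hU hxU⟩
    obtain ⟨U, hU, hxU, hlt⟩ := this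
    filter_upwards [(hU.preimage continuous_subtype_val).mem_nhds
      (show (⟨x, hx⟩ : {x // ρ x = σ}) ∈ Subtype.val ⁻¹' U from hxU)] with y hy
    have := hlt x ⟨hxU, h1⟩ y.1 ⟨hy, (hρH σ y.1).1 y.2.ge⟩
    rw [abs_lt] at this
    constructor <;> linarith
  choose g hg using happ
  have hgd : ∀ σ (y : {x // ρ x = σ}), g (ρ y.1) ⟨y.1, rfl⟩ = g σ y := by
    rintro σ ⟨y, rfl⟩
    rfl
  obtain ⟨F, h1, h2, h3⟩ := core ρ (fun x => g (ρ x) ⟨x, rfl⟩) β₀ γ₀ hβ₀1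
    (fun α => by
      have : {x | α ≤ ρ x} = H α := by ext x; exact hρH α x
      rw [this]
      exact oscDeriv_closed f ε α)
    (fun x => by
      have : ContinuousOn (fun x => g (ρ x) ⟨x, rfl⟩) {y | ρ y = ρ x} := by
        rw [continuousOn_iff_continuous_domRestrict]
        exact (g (ρ x)).continuous.congr fun y => (hgd (ρ x) y).symm
      exact this x rfl)
    (fun x => by
      by_contra hc
      have := (hρH _ x).1 (not_lt.1 hc)
      rw [hemp] at this
      exact this)
    (by
      rw [← Cardinal.le_aleph0_iff_set_countable, Cardinal.mk_Iio_ordinal]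
      rw [Cardinal.lt_ord, Cardinal.lt_aleph_one_iff] at hγ₀
      exact Cardinal.lift_le_aleph0.2 hγ₀)
  refine ⟨_, F, h1, fun x => ?_, h2, h3⟩
  have := hg (ρ x) ⟨x, rfl⟩
  rw [abs_le]
  constructor <;> linarith [this.1, this.2]
end

section
/- Let K be a compact metric space, ξ₁, ξ₂ countable ordinals, and f : K → ℝ. Then β(f) ≤ ω^{ξ₁+ξ₂} if and only if there exists a sequence (fₙ) of real-valued Baire class one functions on K converging pointwise to f such that β(fₙ) ≤ ω^{ξ₁} for all n and γ((fₙ)) ≤ ω^{ξ₂}. -/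
open Filter Topology Set Ordinal

namespace S12

universe u v

/-! ### Natural (Hessenberg) sum of ordinals -/

noncomputable def nad : Ordinal.{u} → Ordinal.{u} → Ordinal.{u}
  | a, b => max (⨆ x : Iio a, (nad x.1 b + 1)) (⨆ y : Iio b, (nad a y.1 + 1))
termination_by a b => (a, b)
decreasing_by
  · exact Prod.Lex.left _ _ x.2
  · exact Prod.Lex.right _ y.2

theorem nad_le_iff {a b c : Ordinal.{u}} :
    nad a b ≤ c ↔ (∀ x < a, nad x b < c) ∧ (∀ y < b, nad a y < c) := by
  rw [nad, max_le_iff, Ordinal.iSup_le_iff, Ordinal.iSup_le_iff]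
  simp [Order.add_one_le_iff]

theorem nad_lt_left {x a b : Ordinal.{u}} (h : x < a) : nad x b < nad a b :=
  (nad_le_iff.1 le_rfl).1 x h

theorem nad_lt_right {y a b : Ordinal.{u}} (h : y < b) : nad a y < nad a b :=
  (nad_le_iff.1 le_rfl).2 y h

theorem nad_le_left {x a b : Ordinal.{u}} (h : x ≤ a) : nad x b ≤ nad a b := by
  rcases h.eq_or_lt with rfl | h
  · exact le_rfl
  · exact (nad_lt_left h).le

theorem nad_le_right {y a b : Ordinal.{u}} (h : y ≤ b) : nad a y ≤ nad a b := by
  rcases h.eq_or_lt with rfl | h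
  · exact le_rfl
  · exact (nad_lt_right h).le

theorem nad_le {x y a b : Ordinal.{u}} (h : x ≤ a) (h' : y ≤ b) : nad x y ≤ nad a b :=
  (nad_le_left h).trans (nad_le_right h')

theorem nad_eq {x y a b : Ordinal.{u}} (h : x ≤ a) (h' : y ≤ b) (he : nad x y = nad a b) :
    x = a ∧ y = b := by
  constructor
  · by_contra hne
    exact absurd he ((nad_lt_left (lt_of_le_of_ne h hne)).trans_le (nad_le_right h')).ne
  · by_contra hne
    exact absurd he ((nad_le_left h).trans_lt (nad_lt_right (lt_of_le_of_ne h' hne))).ne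

theorem nad_split {ρ : Ordinal.{u}} (hρ : 0 < ρ) (hcl : ∀ a < ρ, ∀ b < ρ, nad a b < ρ) :
    ∀ a b : Ordinal.{u}, ∀ m n : ℕ, ∀ a' < ρ, ∀ b' < ρ, a = ρ * m + a' → b = ρ * n + b' →
      nad a b ≤ ρ * ((m + n : ℕ) : Ordinal) + nad a' b' := by
  have key : ∀ (m : ℕ) (a' x : Ordinal.{u}), a' < ρ → x < ρ * m + a' →
      ∃ m' : ℕ, ∃ x' < ρ, x = ρ * m' + x' ∧ (m' < m ∨ (m' = m ∧ x' < a')) := by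
    intro m a' x ha' hx
    have h1 : x / ρ ≤ m := by
      rw [← Order.lt_add_one_iff, ← Ordinal.lt_mul_iff_div_lt hρ.ne', mul_add_one]
      exact hx.trans (by gcongr)
    obtain ⟨m', hm'⟩ := Ordinal.lt_omega0.1 (h1.trans_lt (Ordinal.natCast_lt_omega0 m))
    refine ⟨m', x % ρ, Ordinal.mod_lt _ hρ.ne', ?_, ?_⟩
    · rw [← hm', Ordinal.div_add_mod]
    · rw [hm'] at h1
      rcases (Nat.cast_le.1 h1).lt_or_eq with h | h
      · exact Or.inl h
      · refine Or.inr ⟨h, ?_⟩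
        rw [← Ordinal.div_add_mod x ρ, hm', h] at hx
        exact lt_of_add_lt_add_left hx
  have key2 : ∀ (k l : ℕ) (s t : Ordinal.{u}), k < l → s < ρ → ρ * (k : Ordinal) + s < ρ * l + t := by
    intro k l s t hkl hs
    calc ρ * (k : Ordinal) + s < ρ * k + ρ := by gcongr
      _ = ρ * ((k + 1 : ℕ) : Ordinal) := by push_cast; rw [mul_add_one]
      _ ≤ ρ * l := by gcongr; exact hkl
      _ ≤ ρ * l + t := le_self_add
  intro a
  induction a using WellFoundedLT.induction with
  | ind a iha =>
  intro b
  induction b using WellFoundedLT.induction with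
  | ind b ihb =>
  intro m n a' ha' b' hb' ha hb
  rw [nad_le_iff]
  constructor
  · intro x hx
    obtain ⟨m', x', hx', hxe, hlt⟩ := key m a' x ha' (ha ▸ hx)
    refine (iha x hx b m' n x' hx' b' hb' hxe hb).trans_lt ?_
    rcases hlt with h | ⟨rfl, h⟩
    · exact key2 _ _ _ _ (by omega) (hcl _ hx' _ hb')
    · have := nad_lt_left (b := b') h
      gcongr
  · intro x hx
    obtain ⟨n', x', hx', hxe, hlt⟩ := key n b' x hb' (hb ▸ hx)
    refine (ihb x hx m n' a' ha' x' hx' ha hxe).trans_lt ?_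
    rcases hlt with h | ⟨rfl, h⟩
    · exact key2 _ _ _ _ (by omega) (hcl _ ha' _ hx')
    · have := nad_lt_right (a := a') h
      gcongr

theorem nad_lt_opow (ξ : Ordinal.{u}) : ∀ a < ω ^ ξ, ∀ b < ω ^ ξ, nad a b < ω ^ ξ := by
  induction ξ using Ordinal.limitRecOn with
  | zero =>
    intro a ha b hb
    simp only [opow_zero, Order.lt_one_iff] at ha hb ⊢
    subst ha hb
    exact le_antisymm (nad_le_iff.2 ⟨fun x hx => absurd hx not_lt_zero, fun x hx => absurd hx not_lt_zero⟩) zero_le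
  | add_one ξ ih =>
    intro a ha b hb
    have hρ : 0 < ω ^ ξ := opow_pos _ omega0_pos
    have aux : ∀ a < ω ^ (ξ + 1), ∃ m : ℕ, a / ω ^ ξ = m := by
      intro a ha
      apply Ordinal.lt_omega0.1
      rw [← Ordinal.lt_mul_iff_div_lt hρ.ne', ← opow_add_one]
      exact ha
    obtain ⟨m, hm⟩ := aux a ha
    obtain ⟨n, hn⟩ := aux b hb
    have h1 := mod_lt a hρ.ne'
    have h2 := mod_lt b hρ.ne'
    refine (nad_split hρ ih a b m n (a % ω ^ ξ) h1 (b % ω ^ ξ) h2 ?_ ?_).trans_lt ?_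
    · rw [← hm, div_add_mod]
    · rw [← hn, div_add_mod]
    · have h3 := ih _ h1 _ h2
      calc ω ^ ξ * ((m + n : ℕ) : Ordinal) + nad (a % ω ^ ξ) (b % ω ^ ξ)
          < ω ^ ξ * ((m + n : ℕ) : Ordinal) + ω ^ ξ := by gcongr
        _ = ω ^ ξ * ((m + n + 1 : ℕ) : Ordinal) := by push_cast; rw [mul_add_one]
        _ < ω ^ ξ * ω := by
            have := natCast_lt_omega0 (m + n + 1)
            gcongr
        _ = ω ^ (ξ + 1) := (opow_add_one _ _).symm
  | limit ξ hξ ih =>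
    intro a ha b hb
    obtain ⟨c, hc, hac⟩ := (lt_opow_of_isSuccLimit omega0_ne_zero hξ).1 ha
    obtain ⟨d, hd, hbd⟩ := (lt_opow_of_isSuccLimit omega0_ne_zero hξ).1 hb
    refine (ih (max c d) (max_lt hc hd) a ?_ b ?_).trans_le ?_
    · exact hac.trans_le (opow_le_opow_right omega0_pos (le_max_left _ _))
    · exact hbd.trans_le (opow_le_opow_right omega0_pos (le_max_right _ _))
    · exact opow_le_opow_right omega0_pos (max_lt hc hd).le

/-! ### Abstract derivations and ranks -/

section Abstract

variable {K : Type v}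

noncomputable def iterD (step : Set K → Set K) (o : Ordinal.{u}) : Set K :=
  Ordinal.limitRecOn o univ (fun _ ih => step ih)
    (fun _ _ ih => ⋂ (β : Ordinal) (h : _), ih β h)

theorem iterD_zero (step : Set K → Set K) : iterD step (0 : Ordinal.{u}) = Set.univ := by
  simp [iterD]

theorem iterD_succ (step : Set K → Set K) (o : Ordinal.{u}) :
    iterD step (o + 1) = step (iterD step o) := by
  simp only [iterD, limitRecOn_add_one]

theorem iterD_limit (step : Set K → Set K) (o : Ordinal.{u}) (ho : Order.IsSuccLimit o) :
    iterD step o = ⋂ β < o, iterD step β := by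
  simp only [iterD]
  rw [limitRecOn_limit _ _ _ _ ho]

theorem iterD_anti {step : Set K → Set K} (hsub : ∀ A, step A ⊆ A) :
    Antitone (iterD.{u} step) := by
  intro a b hab
  induction b using Ordinal.limitRecOn with
  | zero =>
    have : a = 0 := le_antisymm hab zero_le
    rw [this]
  | add_one b ih =>
    rcases hab.eq_or_lt with rfl | h
    · exact le_rfl
    · rw [iterD_succ]
      exact (hsub _).trans (ih (Order.lt_add_one_iff.1 h))
  | limit b hb ih =>
    rcases hab.eq_or_lt with rfl | h
    · exact le_rfl
    · rw [iterD_limit _ _ hb]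
      exact iInter₂_subset a h

theorem iterD_closed [TopologicalSpace K] {step : Set K → Set K}
    (hcl : ∀ A, IsClosed A → IsClosed (step A)) (o : Ordinal.{u}) : IsClosed (iterD step o) := by
  induction o using Ordinal.limitRecOn with
  | zero => rw [iterD_zero]; exact isClosed_univ (X := K)
  | add_one b ih => rw [iterD_succ]; exact hcl _ ih
  | limit b hb ih =>
    rw [iterD_limit _ _ hb]
    exact isClosed_iInter fun i => isClosed_iInter fun hi => ih i hi

theorem iterD_subset {step : Set K → Set K} (hsub : ∀ A, step A ⊆ A)
    (hmono : ∀ A B, A ⊆ B → step A ⊆ step B) (r : K → Ordinal.{u})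
    (hr : ∀ x, x ∉ step {y | r x ≤ r y}) (o : Ordinal.{u}) : iterD step o ⊆ {x | o ≤ r x} := by
  induction o using Ordinal.limitRecOn with
  | zero => intro x _; exact zero_le (a := r x)
  | add_one b ih =>
    intro x hx
    rw [iterD_succ] at hx
    have h1 : b ≤ r x := ih (hsub _ hx)
    rcases h1.eq_or_lt with rfl | h
    · exact absurd (hmono _ _ ih hx) (hr x)
    · exact Order.add_one_le_iff.2 h
  | limit b hb ih =>
    intro x hx
    rw [iterD_limit _ _ hb] at hx
    simp only [mem_iInter] at hx
    refine (hb.le_iff_forall_le).2 fun c hc => ih c hc (hx c hc)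

theorem exists_rank {step : Set K → Set K} (hsub : ∀ A, step A ⊆ A) (o : Ordinal.{u})
    (ho : iterD step o = ∅) :
    ∃ r : K → Ordinal.{u}, (∀ x, r x < o) ∧ ∀ x a, x ∈ iterD step a ↔ a ≤ r x := by
  have h : ∀ x : K, ∃ r < o, ∀ a, x ∈ iterD step a ↔ a ≤ r := by
    intro x
    have hne : {a : Ordinal.{u} | x ∉ iterD step a}.Nonempty := ⟨o, by simp [ho]⟩
    set b := sInf {a : Ordinal.{u} | x ∉ iterD step a} with hb
    have hbm : x ∉ iterD step b := csInf_mem hne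
    have hbl : ∀ a < b, x ∈ iterD step a := fun a ha => by
      by_contra hcon
      exact absurd (csInf_le' hcon) (not_le.2 ha)
    have hbo : b ≤ o := csInf_le' (by simp [ho])
    rcases Ordinal.zero_or_succ_or_isSuccLimit b with h0 | ⟨c, hc⟩ | hl
    · rw [h0, iterD_zero] at hbm
      exact absurd (mem_univ x) hbm
    · have hc' : b = c + 1 := by rw [← hc]; rfl
      refine ⟨c, ?_, fun a => ⟨fun hx => ?_, fun hac => ?_⟩⟩
      · exact Order.add_one_le_iff.1 (hc' ▸ hbo)
      · by_contra hcon
        apply hbm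
        refine iterD_anti hsub ?_ hx
        rw [hc']
        exact Order.add_one_le_iff.2 (not_le.1 hcon)
      · apply hbl
        rw [hc']
        exact Order.lt_add_one_iff.2 hac
    · exfalso
      apply hbm
      rw [iterD_limit _ _ hl]
      simp only [mem_iInter]
      exact hbl
  choose r hr using h
  exact ⟨r, fun x => (hr x).1, fun x => (hr x).2⟩

theorem emptyIndex_le_iff {S : Ordinal.{u} → Set K} (hS : Antitone S) {o : Ordinal.{u}}
    (ho : o < (Cardinal.aleph 1).ord) : emptyIndex S ≤ o ↔ S o = ∅ := by
  unfold emptyIndex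
  constructor
  · intro h
    split_ifs at h with hex
    · have h1 : S (sInf {α | S α = ∅}) = ∅ := csInf_mem (s := {α | S α = ∅}) hex
      exact subset_empty_iff.1 (h1 ▸ hS h)
    · exact absurd h (not_le.2 ho)
  · intro h
    rw [dif_pos ⟨o, h⟩]
    exact csInf_le' h

end Abstract


/-! ### Reformulation of the two indices through rank functions -/

section Bridge

variable {K : Type v} [TopologicalSpace K]

def OscLe (f : K → ℝ) (o : Ordinal.{u}) : Prop :=
  ∀ ε > 0, ∃ r : K → Ordinal.{u}, (∀ x, r x < o) ∧
    ∀ x, ∀ᶠ y in 𝓝 x, r y ≤ r x ∧ (r y = r x → |f y - f x| < ε)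

def SeqLe (F : ℕ → K → ℝ) (o : Ordinal.{u}) : Prop :=
  ∀ ε > 0, ∃ r : K → Ordinal.{u}, (∀ x, r x < o) ∧
    ∀ x, ∃ m : ℕ, ∀ᶠ y in 𝓝 x, r y ≤ r x ∧
      (r y = r x → ∀ n₁ > m, ∀ n₂ > m, |F n₁ y - F n₂ y| < ε)

theorem oscStep_sub (f : K → ℝ) (ε : ℝ) (A : Set K) : oscStep f ε A ⊆ A := fun _ hx => hx.1

theorem seqStep_sub (f : ℕ → K → ℝ) (ε : ℝ) (A : Set K) : seqStep f ε A ⊆ A := fun _ hx => hx.1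

theorem oscStep_mono (f : K → ℝ) (ε : ℝ) (A B : Set K) (h : A ⊆ B) :
    oscStep f ε A ⊆ oscStep f ε B := by
  rintro x ⟨hx, hU⟩
  refine ⟨h hx, fun U hUo hxU => ?_⟩
  obtain ⟨x₁, h₁, x₂, h₂, h₃⟩ := hU U hUo hxU
  exact ⟨x₁, ⟨h₁.1, h h₁.2⟩, x₂, ⟨h₂.1, h h₂.2⟩, h₃⟩

theorem seqStep_mono (f : ℕ → K → ℝ) (ε : ℝ) (A B : Set K) (h : A ⊆ B) :
    seqStep f ε A ⊆ seqStep f ε B := by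
  rintro x ⟨hx, hU⟩
  refine ⟨h hx, fun U hUo hxU m => ?_⟩
  obtain ⟨n₁, n₂, h₁, h₂, x', hx', h₃⟩ := hU U hUo hxU m
  exact ⟨n₁, n₂, h₁, h₂, x', ⟨hx'.1, h hx'.2⟩, h₃⟩

theorem oscStep_closed (f : K → ℝ) (ε : ℝ) (A : Set K) (h : IsClosed A) :
    IsClosed (oscStep f ε A) := by
  rw [← closure_subset_iff_isClosed]
  intro x hx
  refine ⟨closure_minimal (oscStep_sub f ε A) h hx, fun U hUo hxU => ?_⟩
  obtain ⟨y, hyU, hy⟩ := mem_closure_iff.1 hx U hUo hxU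
  exact hy.2 U hUo hyU

theorem seqStep_closed (f : ℕ → K → ℝ) (ε : ℝ) (A : Set K) (h : IsClosed A) :
    IsClosed (seqStep f ε A) := by
  rw [← closure_subset_iff_isClosed]
  intro x hx
  refine ⟨closure_minimal (seqStep_sub f ε A) h hx, fun U hUo hxU => ?_⟩
  obtain ⟨y, hyU, hy⟩ := mem_closure_iff.1 hx U hUo hxU
  exact hy.2 U hUo hyU

theorem oscDeriv_eq (f : K → ℝ) (ε : ℝ) :
    oscDeriv.{v, u} f ε Set.univ = iterD (oscStep f ε) := rfl

theorem seqDeriv_eq (f : ℕ → K → ℝ) (ε : ℝ) :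
    seqDeriv.{v, u} f ε Set.univ = iterD (seqStep f ε) := rfl

theorem beta_le_iff_empty (f : K → ℝ) {o : Ordinal.{u}} (ho : o < (Cardinal.aleph 1).ord) :
    beta f ≤ o ↔ ∀ ε > 0, iterD (oscStep f ε) o = ∅ := by
  unfold beta betaOn
  rw [Ordinal.iSup_le_iff]
  simp only [betaEpsOn, oscDeriv_eq, Subtype.forall]
  refine forall₂_congr fun ε hε => ?_
  exact emptyIndex_le_iff (iterD_anti (oscStep_sub f ε)) ho

theorem gamma_le_iff_empty (f : ℕ → K → ℝ) {o : Ordinal.{u}} (ho : o < (Cardinal.aleph 1).ord) :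
    gamma f ≤ o ↔ ∀ ε > 0, iterD (seqStep f ε) o = ∅ := by
  unfold _root_.gamma gammaOn
  rw [Ordinal.iSup_le_iff]
  simp only [gammaEpsOn, seqDeriv_eq, Subtype.forall]
  refine forall₂_congr fun ε hε => ?_
  exact emptyIndex_le_iff (iterD_anti (seqStep_sub f ε)) ho

theorem beta_le_iff (f : K → ℝ) {o : Ordinal.{u}} (ho : o < (Cardinal.aleph 1).ord) :
    beta f ≤ o ↔ OscLe f o := by
  rw [beta_le_iff_empty f ho]
  constructor
  · intro h ε hε
    obtain ⟨r, hro, hr⟩ := exists_rank (oscStep_sub f ε) o (h ε hε)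
    refine ⟨r, hro, fun x => ?_⟩
    have hx1 : x ∈ iterD (oscStep f ε) (r x) := (hr x _).2 le_rfl
    have hx2 : x ∉ iterD (oscStep f ε) (r x + 1) := fun hc =>
      absurd ((hr x _).1 hc) (not_le.2 (Order.lt_add_one_iff.2 le_rfl))
    have e1 : ∀ᶠ y in 𝓝 x, y ∉ iterD (oscStep f ε) (r x + 1) :=
      (iterD_closed (oscStep_closed f ε) (r x + 1)).isOpen_compl.mem_nhds hx2
    rw [iterD_succ] at hx2
    have : ∃ U : Set K, IsOpen U ∧ x ∈ U ∧
        ∀ x₁ ∈ U ∩ iterD (oscStep f ε) (r x), ∀ x₂ ∈ U ∩ iterD (oscStep f ε) (r x),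
          |f x₁ - f x₂| < ε := by
      by_contra hcon
      push Not at hcon
      exact hx2 ⟨hx1, hcon⟩
    obtain ⟨U, hUo, hxU, hU⟩ := this
    filter_upwards [e1, hUo.mem_nhds hxU] with y hy hyU
    refine ⟨?_, fun hyx => hU y ⟨hyU, (hr y _).2 hyx.ge⟩ x ⟨hxU, hx1⟩⟩
    rw [hr, not_le, Order.lt_add_one_iff] at hy
    exact hy
  · intro h ε hε
    obtain ⟨r, hro, hr⟩ := h (ε / 2) (by positivity)
    have hs := iterD_subset (oscStep_sub f ε) (oscStep_mono f ε) r ?_ o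
    · exact eq_empty_of_forall_notMem fun x hx => absurd (hs hx) (not_le.2 (hro x))
    · rintro x ⟨_, hx⟩
      obtain ⟨U, hU, hUo, hxU⟩ := eventually_nhds_iff.1 (hr x)
      obtain ⟨x₁, h₁, x₂, h₂, h₃⟩ := hx U hUo hxU
      have a1 := (hU x₁ h₁.1).2 (le_antisymm (hU x₁ h₁.1).1 h₁.2)
      have a2 := (hU x₂ h₂.1).2 (le_antisymm (hU x₂ h₂.1).1 h₂.2)
      rw [abs_lt] at a1 a2
      have : |f x₁ - f x₂| < ε := by rw [abs_lt]; constructor <;> linarith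
      linarith

theorem gamma_le_iff (f : ℕ → K → ℝ) {o : Ordinal.{u}} (ho : o < (Cardinal.aleph 1).ord) :
    gamma f ≤ o ↔ SeqLe f o := by
  rw [gamma_le_iff_empty f ho]
  constructor
  · intro h ε hε
    obtain ⟨r, hro, hr⟩ := exists_rank (seqStep_sub f ε) o (h ε hε)
    refine ⟨r, hro, fun x => ?_⟩
    have hx1 : x ∈ iterD (seqStep f ε) (r x) := (hr x _).2 le_rfl
    have hx2 : x ∉ iterD (seqStep f ε) (r x + 1) := fun hc =>
      absurd ((hr x _).1 hc) (not_le.2 (Order.lt_add_one_iff.2 le_rfl))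
    have e1 : ∀ᶠ y in 𝓝 x, y ∉ iterD (seqStep f ε) (r x + 1) :=
      (iterD_closed (seqStep_closed f ε) (r x + 1)).isOpen_compl.mem_nhds hx2
    rw [iterD_succ] at hx2
    have : ∃ U : Set K, IsOpen U ∧ x ∈ U ∧ ∃ m : ℕ, ∀ n₁ n₂ : ℕ, m < n₂ → n₂ < n₁ →
        ∀ x' ∈ U ∩ iterD (seqStep f ε) (r x), |f n₁ x' - f n₂ x'| < ε := by
      by_contra hcon
      push Not at hcon
      exact hx2 ⟨hx1, hcon⟩
    obtain ⟨U, hUo, hxU, m, hU⟩ := this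
    refine ⟨m, ?_⟩
    filter_upwards [e1, hUo.mem_nhds hxU] with y hy hyU
    refine ⟨?_, fun hyx n₁ hn₁ n₂ hn₂ => ?_⟩
    · rw [hr, not_le, Order.lt_add_one_iff] at hy
      exact hy
    · have hyD : y ∈ U ∩ iterD (seqStep f ε) (r x) := ⟨hyU, (hr y _).2 hyx.ge⟩
      rcases lt_trichotomy n₁ n₂ with hlt | heq | hgt
      · rw [abs_sub_comm]; exact hU n₂ n₁ hn₁ hlt y hyD
      · subst heq; simpa using hε
      · exact hU n₁ n₂ hn₂ hgt y hyD
  · intro h ε hε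
    obtain ⟨r, hro, hr⟩ := h ε hε
    have hs := iterD_subset (seqStep_sub f ε) (seqStep_mono f ε) r ?_ o
    · exact eq_empty_of_forall_notMem fun x hx => absurd (hs hx) (not_le.2 (hro x))
    · rintro x ⟨_, hx⟩
      obtain ⟨m, hm⟩ := hr x
      obtain ⟨U, hU, hUo, hxU⟩ := eventually_nhds_iff.1 hm
      obtain ⟨n₁, n₂, h₁, h₂, x', hx', h₃⟩ := hx U hUo hxU m
      have a1 := (hU x' hx'.1).2 (le_antisymm (hU x' hx'.1).1 hx'.2) n₁ (h₁.trans h₂) n₂ h₁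
      linarith

/-! ### Closure properties -/

theorem OscLe.add {f g : K → ℝ} {ξ : Ordinal.{u}} (hf : OscLe f (ω ^ ξ)) (hg : OscLe g (ω ^ ξ)) :
    OscLe (fun x => f x + g x) (ω ^ ξ) := by
  intro ε hε
  obtain ⟨r, hr, hr'⟩ := hf (ε / 2) (by positivity)
  obtain ⟨s, hs, hs'⟩ := hg (ε / 2) (by positivity)
  refine ⟨fun x => nad (r x) (s x), fun x => nad_lt_opow ξ _ (hr x) _ (hs x), fun x => ?_⟩
  filter_upwards [hr' x, hs' x] with y h1 h2
  refine ⟨nad_le h1.1 h2.1, fun he => ?_⟩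
  obtain ⟨e1, e2⟩ := nad_eq h1.1 h2.1 he
  have a1 := abs_lt.1 (h1.2 e1)
  have a2 := abs_lt.1 (h2.2 e2)
  rw [abs_lt]; constructor <;> linarith

theorem SeqLe.add {f g : ℕ → K → ℝ} {ξ : Ordinal.{u}} (hf : SeqLe f (ω ^ ξ))
    (hg : SeqLe g (ω ^ ξ)) : SeqLe (fun n x => f n x + g n x) (ω ^ ξ) := by
  intro ε hε
  obtain ⟨r, hr, hr'⟩ := hf (ε / 2) (by positivity)
  obtain ⟨s, hs, hs'⟩ := hg (ε / 2) (by positivity)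
  refine ⟨fun x => nad (r x) (s x), fun x => nad_lt_opow ξ _ (hr x) _ (hs x), fun x => ?_⟩
  obtain ⟨m, hm⟩ := hr' x
  obtain ⟨m', hm'⟩ := hs' x
  refine ⟨max m m', ?_⟩
  filter_upwards [hm, hm'] with y h1 h2
  refine ⟨nad_le h1.1 h2.1, fun he n₁ hn₁ n₂ hn₂ => ?_⟩
  obtain ⟨e1, e2⟩ := nad_eq h1.1 h2.1 he
  have a1 := abs_lt.1 (h1.2 e1 n₁ ((le_max_left _ _).trans_lt hn₁) n₂
    ((le_max_left _ _).trans_lt hn₂))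
  have a2 := abs_lt.1 (h2.2 e2 n₁ ((le_max_right _ _).trans_lt hn₁) n₂
    ((le_max_right _ _).trans_lt hn₂))
  rw [abs_lt]; constructor <;> linarith

theorem OscLe.lip {f : K → ℝ} {o : Ordinal.{u}} (hf : OscLe f o) (T : ℝ → ℝ)
    (hT : ∀ a b, |T a - T b| ≤ |a - b|) : OscLe (fun x => T (f x)) o := by
  intro ε hε
  obtain ⟨r, hr, hr'⟩ := hf ε hε
  refine ⟨r, hr, fun x => ?_⟩
  filter_upwards [hr' x] with y h1
  exact ⟨h1.1, fun he => (hT _ _).trans_lt (h1.2 he)⟩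

theorem SeqLe.lip {f : ℕ → K → ℝ} {o : Ordinal.{u}} (hf : SeqLe f o) (T : ℝ → ℝ)
    (hT : ∀ a b, |T a - T b| ≤ |a - b|) : SeqLe (fun n x => T (f n x)) o := by
  intro ε hε
  obtain ⟨r, hr, hr'⟩ := hf ε hε
  refine ⟨r, hr, fun x => ?_⟩
  obtain ⟨m, hm⟩ := hr' x
  refine ⟨m, ?_⟩
  filter_upwards [hm] with y h1
  exact ⟨h1.1, fun he n₁ h n₂ h' => (hT _ _).trans_lt (h1.2 he n₁ h n₂ h')⟩

end Bridge


/-! ### From sequences to the limit function -/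

theorem backward {K : Type v} [TopologicalSpace K] {F : ℕ → K → ℝ} {f : K → ℝ}
    {a b : Ordinal.{u}} (hlim : ∀ x, Tendsto (fun n => F n x) atTop (nhds (f x)))
    (hF : ∀ n, OscLe (F n) a) (hS : SeqLe F b) :
    ∀ ε > 0, iterD (oscStep f ε) (a * b) = ∅ := by
  intro ε hε
  obtain ⟨ρ, hρ, hρ'⟩ := hS (ε / 4) (by positivity)
  have anti := iterD_anti.{u} (oscStep_sub f ε)
  suffices H : ∀ α, iterD (oscStep f ε) (a * α) ⊆ {x | α ≤ ρ x} from
    eq_empty_of_forall_notMem fun x hx => absurd (H b hx) (not_le.2 (hρ x))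
  intro α
  induction α using Ordinal.limitRecOn with
  | zero => intro x _; exact zero_le (a := ρ x)
  | limit α hα ih =>
    intro x hx
    refine (hα.le_iff_forall_le).2 fun c hc => ih c hc (anti ?_ hx)
    gcongr
  | add_one α ih =>
    intro x hx
    have hx0 : α ≤ ρ x := ih (anti (by gcongr; exact le_self_add) hx)
    rcases hx0.eq_or_lt with hαx | h
    swap
    · exact Order.add_one_le_iff.2 h
    exfalso
    obtain ⟨m, hm⟩ := hρ' x
    obtain ⟨U, hU, hUo, hxU⟩ := eventually_nhds_iff.1 hm
    obtain ⟨s, hs, hs'⟩ := hF (m + 1) (ε / 4) (by positivity)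
    have close : ∀ y ∈ U, y ∈ iterD (oscStep f ε) (a * α) → |f y - F (m + 1) y| ≤ ε / 4 := by
      intro y hyU hy
      have hyx : ρ y = ρ x := le_antisymm (hU y hyU).1 (hαx ▸ ih hy)
      have ht : Tendsto (fun n => |F n y - F (m + 1) y|) atTop (𝓝 |f y - F (m + 1) y|) :=
        ((hlim y).sub_const _).abs
      refine le_of_tendsto ht ?_
      filter_upwards [eventually_gt_atTop m] with n hn
      exact ((hU y hyU).2 hyx n hn (m + 1) (Nat.lt_succ_self m)).le
    have claim : ∀ η, ∀ y ∈ U, y ∈ iterD (oscStep f ε) (a * α + η) → η ≤ s y := by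
      intro η
      induction η using Ordinal.limitRecOn with
      | zero => intro y _ _; exact zero_le
      | limit η hη ih2 =>
        intro y hyU hy
        refine (hη.le_iff_forall_le).2 fun c hc => ih2 c hc y hyU (anti ?_ hy)
        gcongr
      | add_one η ih2 =>
        intro y hyU hy
        have h1 : η ≤ s y := ih2 y hyU (anti (by gcongr; exact le_self_add) hy)
        rcases h1.eq_or_lt with hη | h
        swap
        · exact Order.add_one_le_iff.2 h
        exfalso
        rw [← add_assoc, iterD_succ] at hy
        obtain ⟨V, hV, hVo, hyV⟩ := eventually_nhds_iff.1 (hs' y)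
        obtain ⟨y₁, ⟨⟨h₁U, h₁V⟩, h₁⟩, y₂, ⟨⟨h₂U, h₂V⟩, h₂⟩, h₃⟩ :=
          hy.2 (U ∩ V) (hUo.inter hVo) ⟨hyU, hyV⟩
        have b1 := (hV y₁ h₁V).2 (le_antisymm (hV y₁ h₁V).1 (hη ▸ ih2 y₁ h₁U h₁))
        have b2 := (hV y₂ h₂V).2 (le_antisymm (hV y₂ h₂V).1 (hη ▸ ih2 y₂ h₂U h₂))
        have c1 := close y₁ h₁U (anti le_self_add h₁)
        have c2 := close y₂ h₂U (anti le_self_add h₂)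
        have : |f y₁ - f y₂| < ε := by
          rw [abs_lt] at b1 b2 ⊢
          rw [abs_le] at c1 c2
          constructor <;> linarith
        linarith
    have := claim a x hxU (by rw [← mul_add_one]; exact hx)
    exact absurd this (not_le.2 (hs x))

/-! ### Constructions -/

section Metric

variable {K : Type v} [MetricSpace K]

theorem smoothing {f : K → ℝ} {ε : ℝ} (r : K → Ordinal.{u})
    (hr : ∀ x, ∀ᶠ y in 𝓝 x, r y ≤ r x ∧ (r y = r x → |f y - f x| < ε)) :
    ∃ g : K → ℝ, (∀ x, |f x - g x| ≤ ε) ∧ ∀ x, ContinuousWithinAt g {y | r y = r x} x := by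
  have main : ∀ ρ : Ordinal.{u}, ∃ G : C({y | r y = ρ}, ℝ), ∀ y, |f y.1 - G y| ≤ ε := by
    intro ρ
    obtain ⟨G, hG⟩ := exists_continuous_forall_mem_convex_of_local_const
      (X := {y | r y = ρ}) (E := ℝ) (t := fun y => Metric.closedBall (f y.1) ε)
      (fun y => convex_closedBall _ _) (by
        intro x
        refine ⟨f x.1, ?_⟩
        have := (continuous_subtype_val.continuousAt (x := x)).eventually (hr x.1)
        filter_upwards [this] with y hy
        have hyx : r y.1 = r x.1 := y.2.trans x.2.symm
        rw [Metric.mem_closedBall, Real.dist_eq, abs_sub_comm]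
        exact (hy.2 hyx).le)
    refine ⟨G, fun y => ?_⟩
    have := hG y
    rwa [Metric.mem_closedBall, Real.dist_eq, abs_sub_comm] at this
  choose G hG using main
  refine ⟨fun x => G (r x) ⟨x, rfl⟩, fun x => hG (r x) ⟨x, rfl⟩, fun x => ?_⟩
  have hc : ContinuousOn (fun x => G (r x) ⟨x, rfl⟩) {y | r y = r x} := by
    rw [continuousOn_iff_continuous_domRestrict]
    have : {y | r y = r x}.domRestrict (fun x => G (r x) ⟨x, rfl⟩) = G (r x) := by
      ext ⟨y, hy⟩
      have : ∀ ρ (h : r y = ρ), G (r y) ⟨y, rfl⟩ = G ρ ⟨y, h⟩ := by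
        rintro _ rfl; rfl
      exact this _ hy
    rw [this]
    exact (G (r x)).continuous
  exact hc x rfl

theorem extension {E : Set K} (hE : IsClosed E) (s : K → Ordinal.{u}) (g : K → ℝ)
    (hus : ∀ x ∈ E, ∀ᶠ y in 𝓝 x, y ∈ E → s y ≤ s x)
    (hc : ∀ x ∈ E, ContinuousWithinAt g (E ∩ {y | s y = s x}) x)
    (o : Ordinal.{u}) (hs : ∀ x, s x < o) :
    ∃ h : K → ℝ, (∀ x ∈ E, h x = g x) ∧ OscLe h o := by
  classical
  let W : Set K := {x | x ∈ E → s x = 0}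
  have hW : IsOpen W := by
    rw [isOpen_iff_mem_nhds]
    intro x hx
    by_cases hxE : x ∈ E
    · filter_upwards [hus x hxE] with y hy hyE
      have := hy hyE
      rw [hx hxE] at this
      exact le_antisymm this zero_le
    · filter_upwards [hE.isOpen_compl.mem_nhds hxE] with y hy hyE
      exact absurd hyE hy
  let C : Set W := Subtype.val ⁻¹' E
  have hC : IsClosed C := hE.preimage continuous_subtype_val
  have hgc : Continuous (fun c : C => g c.1.1) := by
    rw [continuous_iff_continuousAt]
    intro c
    have h1 := hc c.1.1 c.2
    refine Tendsto.comp h1 (tendsto_nhdsWithin_iff.2 ⟨?_, ?_⟩)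
    · exact (continuous_subtype_val.comp continuous_subtype_val).continuousAt
    · refine Eventually.of_forall fun d => ⟨d.2, ?_⟩
      show s d.1.1 = s c.1.1
      rw [d.1.2 d.2, c.1.2 c.2]
  obtain ⟨G, hG⟩ := ContinuousMap.exists_restrict_eq hC ⟨_, hgc⟩
  have hGe : ∀ (x : K) (hxW : x ∈ W), x ∈ E → G ⟨x, hxW⟩ = g x := by
    intro x hxW hxE
    exact DFunLike.congr_fun hG ⟨⟨x, hxW⟩, hxE⟩
  let h : K → ℝ := fun x => if hx : x ∈ W then G ⟨x, hx⟩ else g x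
  have hhE : ∀ x ∈ E, h x = g x := by
    intro x hx
    by_cases hxW : x ∈ W
    · simp only [h, dif_pos hxW]; exact hGe x hxW hx
    · simp only [h, dif_neg hxW]
  have hhW : ContinuousOn h W := by
    rw [continuousOn_iff_continuous_domRestrict]
    have : W.domRestrict h = G := by
      ext ⟨y, hy⟩
      exact dif_pos hy
    rw [this]
    exact G.continuous
  refine ⟨h, hhE, fun ε hε => ⟨fun x => if x ∈ E then s x else 0, fun x => ?_, fun x => ?_⟩⟩
  · dsimp only
    split_ifs
    · exact hs x
    · exact zero_le.trans_lt (hs x)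
  · dsimp only
    by_cases hxW : x ∈ W
    · have hRW : ∀ y ∈ W, (if y ∈ E then s y else 0) = 0 := by
        intro y hy
        split_ifs with hyE
        · exact hy hyE
        · rfl
      have hcont : ContinuousAt h x := hhW.continuousAt (hW.mem_nhds hxW)
      filter_upwards [hW.mem_nhds hxW, Metric.tendsto_nhds.1 hcont ε hε] with y hyW hy
      rw [hRW x hxW, hRW y hyW]
      exact ⟨le_rfl, fun _ => by rwa [Real.dist_eq] at hy⟩
    · have hxE : x ∈ E := by
        by_contra hcon
        exact hxW fun h => absurd h hcon
      have hsx : s x ≠ 0 := fun h => hxW fun _ => h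
      have h2 := Metric.tendsto_nhds.1 (hc x hxE) ε hε
      rw [eventually_nhdsWithin_iff] at h2
      filter_upwards [hus x hxE, h2] with y hy1 hy2
      rw [if_pos hxE]
      split_ifs with hyE
      · refine ⟨hy1 hyE, fun he => ?_⟩
        rw [hhE y hyE, hhE x hxE, ← Real.dist_eq]
        exact hy2 ⟨hyE, he⟩
      · exact ⟨zero_le, fun he => absurd he.symm hsx⟩

theorem approx {f : K → ℝ} {a b : Ordinal.{u}} (ha : a ≠ 0) (hf : OscLe f (a * b)) {ε : ℝ}
    (hε : 0 < ε) : ∃ (g : K → ℝ) (F : ℕ → K → ℝ), (∀ x, |f x - g x| ≤ ε) ∧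
      (∀ n, OscLe (F n) a) ∧ SeqLe F b ∧ ∀ x, Tendsto (fun n => F n x) atTop (𝓝 (g x)) := by
  obtain ⟨r, hro, hr⟩ := hf ε hε
  obtain ⟨g, hfg, hg⟩ := smoothing r hr
  let q : K → Ordinal.{u} := fun x => r x / a
  let s : K → Ordinal.{u} := fun x => r x % a
  have hqs : ∀ x, a * q x + s x = r x := fun x => div_add_mod _ _
  have hru : ∀ x, ∀ᶠ y in 𝓝 x, r y ≤ r x := fun x => (hr x).mono fun y hy => hy.1
  have hqu : ∀ x, ∀ᶠ y in 𝓝 x, q y ≤ q x := fun x => (hru x).mono fun y hy => div_le_left hy a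
  let E : ℕ → Set K := fun n => {x | ∀ z, q x < q z → 1 / ((n : ℝ) + 1) ≤ dist x z}
  have hpos : ∀ n : ℕ, 0 < 1 / ((n : ℝ) + 1) := fun n => by positivity
  have hloc : ∀ n x, ∀ᶠ y in 𝓝 x, y ∈ E n → q y = q x := by
    intro n x
    filter_upwards [hqu x, Metric.ball_mem_nhds x (hpos n)] with y hy1 hy2 hyE
    by_contra hne
    have := hyE x (lt_of_le_of_ne hy1 hne)
    rw [Metric.mem_ball] at hy2
    linarith
  have hEc : ∀ n, IsClosed (E n) := by
    intro n
    rw [← closure_subset_iff_isClosed]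
    intro x hx z hz
    refine le_of_forall_pos_le_add fun δ hδ => ?_
    obtain ⟨y, hyE, hy1, hy2⟩ := (mem_closure_iff_frequently.1 hx).and_eventually
      ((hloc n x).and (Metric.ball_mem_nhds x hδ)) |>.exists
    have h1 := hyE z (by rw [hy1 hyE]; exact hz)
    have h2 := dist_triangle y x z
    have h3 : dist y x < δ := hy2
    linarith
  have hext : ∀ n, ∃ h : K → ℝ, (∀ x ∈ E n, h x = g x) ∧ OscLe h a := by
    intro n
    refine extension (hEc n) s g ?_ ?_ a (fun x => mod_lt _ ha)
    · intro x hx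
      filter_upwards [hloc n x, hru x] with y hy1 hy2 hyE
      rw [← hqs y, ← hqs x, hy1 hyE] at hy2
      exact le_of_add_le_add_left hy2
    · intro x hx
      refine (hg x).mono_of_mem_nhdsWithin ?_
      have : ∀ᶠ y in 𝓝[E n ∩ {y | s y = s x}] x, r y = r x := by
        rw [eventually_nhdsWithin_iff]
        filter_upwards [hloc n x] with y hy1 hy
        rw [← hqs y, ← hqs x, hy1 hy.1, hy.2]
      exact this
  choose F hF hFo using hext
  have hloc2 : ∀ x, ∃ m : ℕ, ∀ᶠ y in 𝓝 x, q y ≤ q x ∧ (q y = q x → ∀ n > m, F n y = g y) := by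
    intro x
    obtain ⟨δ, hδ, hball⟩ := Metric.eventually_nhds_iff_ball.1 (hqu x)
    obtain ⟨m, hm⟩ := exists_nat_one_div_lt (half_pos hδ)
    refine ⟨m, ?_⟩
    filter_upwards [Metric.ball_mem_nhds x (half_pos hδ), hqu x] with y hy hyq
    refine ⟨hyq, fun he n hn => hF n y fun z hz => ?_⟩
    rw [he] at hz
    have h1 : δ ≤ dist z x := by
      by_contra hcon
      exact absurd (hball z (not_le.1 hcon)) (not_le.2 hz)
    have h2 : dist y x < δ / 2 := hy
    have h3 := dist_triangle z y x
    have h4 : 1 / ((n : ℝ) + 1) ≤ 1 / ((m : ℝ) + 1) :=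
      one_div_le_one_div_of_le (by positivity) (by
        have : (m : ℝ) ≤ n := by exact_mod_cast hn.le
        linarith)
    rw [dist_comm y z]
    linarith
  refine ⟨g, F, hfg, hFo, fun ε' hε' => ⟨q, fun x => ?_, fun x => ?_⟩, fun x => ?_⟩
  · exact (lt_mul_iff_div_lt ha).1 (hro x)
  · obtain ⟨m, hm⟩ := hloc2 x
    refine ⟨m, ?_⟩
    filter_upwards [hm] with y hy
    refine ⟨hy.1, fun he n₁ hn₁ n₂ hn₂ => ?_⟩
    rw [hy.2 he n₁ hn₁, hy.2 he n₂ hn₂]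
    simpa using hε'
  · obtain ⟨m, hm⟩ := hloc2 x
    refine tendsto_const_nhds.congr' ?_
    filter_upwards [eventually_gt_atTop m] with n hn
    exact (hm.self_of_nhds.2 rfl n hn).symm

end Metric

section Forward

variable {K : Type v} [MetricSpace K]

noncomputable def trunc (c x : ℝ) : ℝ := max (-c) (min c x)

theorem trunc_lip (c a b : ℝ) : |trunc c a - trunc c b| ≤ |a - b| := by
  unfold trunc
  have h1 := abs_max_sub_max_le_max (-c) (min c a) (-c) (min c b)
  have h2 := abs_min_sub_min_le_max c a c b
  rw [_root_.sub_self, abs_zero, max_eq_right (a := (0 : ℝ)) (abs_nonneg _)] at h1 h2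
  exact h1.trans h2

theorem trunc_abs {c : ℝ} (hc : 0 ≤ c) (a : ℝ) : |trunc c a| ≤ c := by
  unfold trunc
  rw [abs_le]
  exact ⟨le_max_left _ _, max_le (by linarith) (min_le_left _ _)⟩

theorem trunc_eq {c a : ℝ} (ha : |a| ≤ c) : trunc c a = a := by
  unfold trunc
  rw [abs_le] at ha
  rw [min_eq_right ha.2, max_eq_right ha.1]

theorem trunc_cont (c : ℝ) : Continuous (trunc c) := by
  unfold trunc
  fun_prop

noncomputable def partS (φ : ℕ → ℕ → K → ℝ) : ℕ → ℕ → K → ℝ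
  | 0, n, x => φ 0 n x
  | N + 1, n, x => partS φ N n x + trunc (2 * (1 / 2) ^ N) (φ (N + 1) n x + -(φ N n x))

theorem forward {f : K → ℝ} (ξ₁ ξ₂ : Ordinal.{u}) (hf : OscLe f (ω ^ (ξ₁ + ξ₂))) :
    ∃ F : ℕ → K → ℝ, (∀ x, Tendsto (fun n => F n x) atTop (𝓝 (f x))) ∧
      (∀ n, OscLe (F n) (ω ^ ξ₁)) ∧ SeqLe F (ω ^ ξ₂) := by
  have hneg : ∀ a b : ℝ, |(-a) - (-b)| ≤ |a - b| := by
    intro a b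
    rw [← abs_neg]
    apply le_of_eq
    congr 1
    ring
  rw [opow_add] at hf
  have hA := fun k : ℕ => approx (opow_ne_zero ξ₁ omega0_ne_zero) hf
    (show (0 : ℝ) < (1 / 2) ^ k by positivity)
  choose g φ hg hφo hφs hφt using hA
  have hSo : ∀ N n, OscLe (partS φ N n) (ω ^ ξ₁) := by
    intro N n
    induction N with
    | zero => exact hφo 0 n
    | succ N ih =>
      exact ih.add (((hφo (N + 1) n).add ((hφo N n).lip (fun a => -a) hneg)).lip
        (trunc (2 * (1 / 2) ^ N)) (trunc_lip _))
  have hSs : ∀ N, SeqLe (partS φ N) (ω ^ ξ₂) := by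
    intro N
    induction N with
    | zero => exact hφs 0
    | succ N ih =>
      exact ih.add (((hφs (N + 1)).add ((hφs N).lip (fun a => -a) hneg)).lip
        (trunc (2 * (1 / 2) ^ N)) (trunc_lip _))
  have hSt : ∀ N x, Tendsto (fun n => partS φ N n x) atTop (𝓝 (g N x)) := by
    intro N x
    induction N with
    | zero => exact hφt 0 x
    | succ N ih =>
      have h1 : |g (N + 1) x + -(g N x)| ≤ 2 * (1 / 2) ^ N := by
        have a1 := abs_le.1 (hg (N + 1) x)
        have a2 := abs_le.1 (hg N x)
        have a3 : (0 : ℝ) < (1 / 2) ^ N := by positivity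
        rw [pow_succ] at a1
        rw [abs_le]
        constructor <;> linarith
      have h2 := ih.add (((trunc_cont (2 * (1 / 2) ^ N)).tendsto _).comp
        ((hφt (N + 1) x).add (hφt N x).neg))
      rw [trunc_eq h1] at h2
      have h3 : g N x + (g (N + 1) x + -(g N x)) = g (N + 1) x := by ring
      rw [h3] at h2
      exact h2
  have htail : ∀ N M, N ≤ M → ∀ n x,
      |partS φ M n x - partS φ N n x| ≤ 4 * (1 / 2) ^ N - 4 * (1 / 2) ^ M := by
    intro N M hNM n x
    induction M, hNM using Nat.le_induction with
    | base => simp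
    | succ M _ ih =>
      have h1 := abs_le.1 (trunc_abs (c := 2 * (1 / 2) ^ M) (by positivity)
        (φ (M + 1) n x + -(φ M n x)))
      have h2 := abs_le.1 ih
      rw [abs_le]
      simp only [partS]
      rw [pow_succ (1 / 2 : ℝ) M]
      constructor <;> linarith
  have htail' : ∀ N n x, N ≤ n → |partS φ n n x - partS φ N n x| ≤ 4 * (1 / 2) ^ N := by
    intro N n x hn
    have := htail N n hn n x
    have h2 : (0 : ℝ) < (1 / 2) ^ n := by positivity
    linarith
  have hsmall : ∀ ε : ℝ, 0 < ε → ∃ N : ℕ, (1 / 2 : ℝ) ^ N < ε := fun ε hε =>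
    exists_pow_lt_of_lt_one hε (by norm_num)
  refine ⟨fun n => partS φ n n, fun x => ?_, fun n => hSo n n, fun ε hε => ?_⟩
  · rw [Metric.tendsto_atTop]
    intro ε hε
    obtain ⟨N, hN⟩ := hsmall (ε / 8) (by positivity)
    obtain ⟨n₀, hn₀⟩ := Metric.tendsto_atTop.1 (hSt N x) (ε / 8) (by positivity)
    refine ⟨max N n₀, fun n hn => ?_⟩
    have h1 := hn₀ n ((le_max_right _ _).trans hn)
    have h2 := htail' N n x ((le_max_left _ _).trans hn)
    have h3 := hg N x
    rw [Real.dist_eq, abs_lt] at h1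
    rw [abs_le] at h2 h3
    rw [Real.dist_eq, abs_lt]
    constructor <;> linarith
  · obtain ⟨N, hN⟩ := hsmall (ε / 16) (by positivity)
    obtain ⟨r, hr, hr'⟩ := hSs N (ε / 4) (by positivity)
    refine ⟨r, hr, fun x => ?_⟩
    obtain ⟨m, hm⟩ := hr' x
    refine ⟨max m N, ?_⟩
    filter_upwards [hm] with y hy
    refine ⟨hy.1, fun he n₁ hn₁ n₂ hn₂ => ?_⟩
    have h1 := hy.2 he n₁ ((le_max_left _ _).trans_lt hn₁) n₂ ((le_max_left _ _).trans_lt hn₂)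
    have h2 := htail' N n₁ y ((le_max_right _ _).trans hn₁.le)
    have h3 := htail' N n₂ y ((le_max_right _ _).trans hn₂.le)
    rw [abs_lt] at h1
    rw [abs_le] at h2 h3
    rw [abs_lt]
    constructor <;> linarith

theorem OscLe.continuous {f : K → ℝ} (hf : OscLe f (1 : Ordinal.{u})) : Continuous f := by
  rw [continuous_iff_continuousAt]
  intro x
  refine Metric.tendsto_nhds.2 fun ε hε => ?_
  obtain ⟨r, hr, hr'⟩ := hf ε hε
  filter_upwards [hr' x] with y hy
  rw [Real.dist_eq]
  exact hy.2 (by rw [Order.lt_one_iff.1 (hr y), Order.lt_one_iff.1 (hr x)])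

theorem OscLe.baireOne {f : K → ℝ} {ξ : Ordinal.{u}} (hf : OscLe f (ω ^ ξ)) : BaireOne f := by
  obtain ⟨F, h1, h2, _⟩ := forward 0 ξ (by rwa [zero_add])
  refine ⟨F, fun n => ?_, h1⟩
  have := h2 n
  rw [opow_zero] at this
  exact this.continuous

end Forward

theorem opow_lt {ξ : Ordinal.{u}} (h : ξ < (Cardinal.aleph 1).ord) :
    ω ^ ξ < (Cardinal.aleph 1).ord := by
  have h0 : ω < (Cardinal.aleph.{u} 1).ord := by
    rw [← Cardinal.ord_aleph0]
    exact Cardinal.ord_lt_ord.2 Cardinal.aleph0_lt_aleph_one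
  exact isPrincipal_opow_ord (Cardinal.aleph0_le_aleph 1) h0 h

theorem add_lt {ξ η : Ordinal.{u}} (h : ξ < (Cardinal.aleph 1).ord)
    (h' : η < (Cardinal.aleph 1).ord) : ξ + η < (Cardinal.aleph 1).ord :=
  isPrincipal_add_ord (Cardinal.aleph0_le_aleph 1) h h'

end S12

theorem statement12 {K : Type*} [MetricSpace K] [CompactSpace K]
    (ξ₁ ξ₂ : Ordinal) (hξ₁ : ξ₁ < (Cardinal.aleph 1).ord) (hξ₂ : ξ₂ < (Cardinal.aleph 1).ord)
    (f : K → ℝ) :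
    beta f ≤ Ordinal.omega0 ^ (ξ₁ + ξ₂) ↔
      ∃ F : ℕ → K → ℝ, (∀ n, BaireOne (F n)) ∧
        (∀ x, Tendsto (fun n => F n x) atTop (nhds (f x))) ∧
        (∀ n, beta (F n) ≤ Ordinal.omega0 ^ ξ₁) ∧
        gamma F ≤ Ordinal.omega0 ^ ξ₂ := by
  have h12 := S12.opow_lt (S12.add_lt hξ₁ hξ₂)
  have h1 := S12.opow_lt hξ₁
  have h2 := S12.opow_lt hξ₂
  constructor
  · intro h
    rw [S12.beta_le_iff f h12] at h
    obtain ⟨F, hF, hFo, hFs⟩ := S12.forward ξ₁ ξ₂ h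
    exact ⟨F, fun n => (hFo n).baireOne, hF, fun n => (S12.beta_le_iff _ h1).2 (hFo n),
      (S12.gamma_le_iff _ h2).2 hFs⟩
  · rintro ⟨F, _, hF, hFo, hFs⟩
    rw [S12.beta_le_iff_empty f h12, opow_add]
    exact S12.backward hF (fun n => (S12.beta_le_iff _ h1).1 (hFo n))
      ((S12.gamma_le_iff _ h2).1 hFs)
end
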